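/- arXiv:1112.0217 — 2 statements merged into one kernel-verified Lean document; each statement's English description precedes it below -/
import Mathlib

section
/- Let M ∈ ℝ^{n×n} be a lower Hessenberg P-matrix, k ∈ [n], B ⊆ [k], and ℓ ∈ {0,…,k−1} with ℓ+1 ∉ B. Then the basis matrix M̄ := (M_{[k][k]})̄_B satisfies m̄_{ij} = 0 whenever i ≤ ℓ < j ≤ k, and consequently the restriction of M̄⁻¹ q_{[k]} to the first ℓ coordinates equals (M_{[ℓ][ℓ]})̄_{B∩[ℓ]}⁻¹ q_{[ℓ]}. -/
open Matrix

/-- The basis matrix `M̄_B`: column `j` is the `j`-th column of `-M` if `j ∈ B`,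
and the `j`-th column of the identity matrix otherwise. -/
def basisMatrix {ι : Type*} [Fintype ι] [DecidableEq ι]
    (M : Matrix ι ι ℝ) (B : Finset ι) : Matrix ι ι ℝ :=
  fun i j => if j ∈ B then -M i j else if i = j then 1 else 0

/-- A P-matrix: every principal minor is positive. -/
def IsPMatrix {ι : Type*} [Fintype ι] [DecidableEq ι] (M : Matrix ι ι ℝ) : Prop :=
  ∀ K : Finset ι, 0 < (M.submatrix (fun i : K => i.1) (fun j : K => j.1)).det

/-- The vector `w(B)` of the complementary pair. -/
noncomputable def wvec {ι : Type*} [Fintype ι] [DecidableEq ι]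
    (M : Matrix ι ι ℝ) (q : ι → ℝ) (B : Finset ι) : ι → ℝ :=
  fun i => if i ∈ B then 0 else ((basisMatrix M B)⁻¹ *ᵥ q) i

/-- The vector `z(B)` of the complementary pair. -/
noncomputable def zvec {ι : Type*} [Fintype ι] [DecidableEq ι]
    (M : Matrix ι ι ℝ) (q : ι → ℝ) (B : Finset ι) : ι → ℝ :=
  fun i => if i ∈ B then ((basisMatrix M B)⁻¹ *ᵥ q) i else 0

/-- `(w, z)` solves the linear complementarity problem LCP(M,q). -/
def SolvesLCP {ι : Type*} [Fintype ι] (M : Matrix ι ι ℝ) (q w z : ι → ℝ) : Prop :=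
  w - M *ᵥ z = q ∧ (∀ i, 0 ≤ w i) ∧ (∀ i, 0 ≤ z i) ∧ w ⬝ᵥ z = 0

/-- `B` is an optimal basis for LCP(M,q). -/
noncomputable def OptimalBasis {ι : Type*} [Fintype ι] [DecidableEq ι]
    (M : Matrix ι ι ℝ) (q : ι → ℝ) (B : Finset ι) : Prop :=
  SolvesLCP M q (wvec M q B) (zvec M q B)

/-- LCP(M,q) is nondegenerate. -/
def Nondeg {ι : Type*} [Fintype ι] [DecidableEq ι] (M : Matrix ι ι ℝ) (q : ι → ℝ) : Prop :=
  ∀ B : Finset ι, ∀ i, ((basisMatrix M B)⁻¹ *ᵥ q) i ≠ 0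

/-- `M` is lower Hessenberg: `m_{ij} = 0` whenever `j - i > 1`. -/
def LowerHessenberg {k : ℕ} (M : Matrix (Fin k) (Fin k) ℝ) : Prop :=
  ∀ i j : Fin k, (i : ℕ) + 1 < (j : ℕ) → M i j = 0

/-- `M` is upper Hessenberg: `m_{ij} = 0` whenever `i - j > 1`. -/
def UpperHessenberg {k : ℕ} (M : Matrix (Fin k) (Fin k) ℝ) : Prop :=
  ∀ i j : Fin k, (j : ℕ) + 1 < (i : ℕ) → M i j = 0

lemma IsPMatrix.submatrix {ι κ : Type*} [Fintype ι] [DecidableEq ι] [Fintype κ] [DecidableEq κ]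
    {M : Matrix ι ι ℝ} (hM : IsPMatrix M) (e : κ ↪ ι) : IsPMatrix (M.submatrix e e) := by
  intro K
  have h := hM (K.map e)
  rw [← Matrix.det_submatrix_equiv_self (K.equivMap e)] at h
  exact h

lemma IsPMatrix.isUnit_det_basisMatrix {ι : Type*} [Fintype ι] [DecidableEq ι]
    {M : Matrix ι ι ℝ} (hM : IsPMatrix M) (B : Finset ι) : IsUnit (basisMatrix M B).det := by
  rw [isUnit_iff_ne_zero, Matrix.twoBlockTriangular_det' _ (· ∈ B)]
  · have h₁ : (basisMatrix M B).toSquareBlockProp (· ∈ B) =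
        -M.submatrix (fun i : B => i.1) (fun j : B => j.1) := by
      ext i j
      simp [Matrix.toSquareBlockProp, basisMatrix]
    have h₂ : (basisMatrix M B).toSquareBlockProp (fun i => ¬ i ∈ B) = 1 := by
      ext i j
      simp [Matrix.toSquareBlockProp, basisMatrix, Matrix.one_apply, Subtype.ext_iff, j.2]
    have h₃ : (-M.submatrix (fun i : B => i.1) (fun j : B => j.1)).det ≠ 0 := by
      rw [Matrix.det_neg]
      exact mul_ne_zero (pow_ne_zero _ (by norm_num)) (hM B).ne'
    rw [h₁, h₂, Matrix.det_one, mul_one]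
    convert h₃
  · intro i hi j hj
    have hij : i ≠ j := fun h => hj (h ▸ hi)
    simp [basisMatrix, hj, hij]

lemma basisMatrix_submatrix {ι κ : Type*} [Fintype ι] [DecidableEq ι] [Fintype κ] [DecidableEq κ]
    (M : Matrix ι ι ℝ) (B : Finset ι) (e : κ ↪ ι) :
    basisMatrix (M.submatrix e e) (Finset.univ.filter (fun j => e j ∈ B)) =
      (basisMatrix M B).submatrix e e := by
  ext i j
  simp [basisMatrix]

/-- If the rows of `A` indexed by the range of `e` vanish outside the columns indexed by that range,
then solving `A x = q` restricts to the principal subsystem along `e`. -/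
lemma Matrix.inv_mulVec_apply_of_submatrix {ι κ R : Type*} [Fintype ι] [DecidableEq ι]
    [Fintype κ] [DecidableEq κ] [CommRing R] (A : Matrix ι ι R) (e : κ ↪ ι)
    (hA : IsUnit A.det) (hAe : IsUnit (A.submatrix e e).det)
    (h : ∀ i, ∀ j ∉ Set.range e, A (e i) j = 0) (q : ι → R) (i : κ) :
    (A⁻¹ *ᵥ q) (e i) = ((A.submatrix e e)⁻¹ *ᵥ (q ∘ e)) i := by
  set x := A⁻¹ *ᵥ q with hx
  have hq : A *ᵥ x = q := by rw [hx, mulVec_mulVec, mul_nonsing_inv _ hA, one_mulVec]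
  have hqe : A.submatrix e e *ᵥ (x ∘ e) = q ∘ e := by
    funext i
    rw [← hq]
    exact Fintype.sum_of_injective e e.injective _ _
      (fun j hj => (congrArg (· * x j) (h i j hj)).trans (zero_mul _)) (fun _ => rfl)
  rw [← hqe, mulVec_mulVec, nonsing_inv_mul _ hAe, one_mulVec, Function.comp_apply]

/-- for a lower Hessenberg P-matrix, if the (1-based) index `ℓ+1`
(0-based value `ℓ`) is not in the basis `B ⊆ [k]`, then the basis matrix of the
`k`-th leading subproblem vanishes at all positions `(i, j)` with
(0-based) `i < ℓ ≤ j`, and consequently the first `ℓ` coordinates of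
`M̄⁻¹ q_{[k]}` coincide with `(M_{[ℓ][ℓ]})̄_{B ∩ [ℓ]}⁻¹ q_{[ℓ]}`. -/
theorem stmt_8 (n : ℕ) (M : Matrix (Fin n) (Fin n) ℝ) (hM : IsPMatrix M)
    (hH : LowerHessenberg M) (q : Fin n → ℝ)
    (k : ℕ) (hk1 : 1 ≤ k) (hkn : k ≤ n)
    (B : Finset (Fin k)) (ℓ : ℕ) (hℓ : ℓ < k)
    (hB : (⟨ℓ, hℓ⟩ : Fin k) ∉ B) :
    (∀ i j : Fin k, (i : ℕ) < ℓ → ℓ ≤ (j : ℕ) →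
      basisMatrix (M.submatrix (Fin.castLE hkn) (Fin.castLE hkn)) B i j = 0) ∧
    (∀ i : Fin ℓ,
      ((basisMatrix (M.submatrix (Fin.castLE hkn) (Fin.castLE hkn)) B)⁻¹
          *ᵥ (fun j => q (Fin.castLE hkn j))) (Fin.castLE (le_of_lt hℓ) i) =
      ((basisMatrix
            (M.submatrix (Fin.castLE (show ℓ ≤ n by omega))
              (Fin.castLE (show ℓ ≤ n by omega)))
            (Finset.univ.filter (fun j : Fin ℓ => Fin.castLE (le_of_lt hℓ) j ∈ B)))⁻¹
          *ᵥ (fun j => q (Fin.castLE (show ℓ ≤ n by omega) j))) i) := by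
  have hzero : ∀ i j : Fin k, (i : ℕ) < ℓ → ℓ ≤ (j : ℕ) →
      basisMatrix (M.submatrix (Fin.castLE hkn) (Fin.castLE hkn)) B i j = 0 := by
    intro i j hi hj
    have hij : i ≠ j := by rintro rfl; omega
    rcases hj.eq_or_lt with hj | hj
    · have hjB : j ∉ B := by rwa [show j = ⟨ℓ, hℓ⟩ from Fin.ext hj.symm]
      simp [basisMatrix, hjB, hij]
    · have hMij : M (Fin.castLE hkn i) (Fin.castLE hkn j) = 0 :=
        hH _ _ (by simp only [Fin.val_castLE]; omega)
      simp [basisMatrix, hMij, hij]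
  refine ⟨hzero, fun i => ?_⟩
  have hMk := hM.submatrix (Fin.castLEEmb hkn)
  have hsub := basisMatrix_submatrix (M.submatrix (Fin.castLE hkn) (Fin.castLE hkn)) B
    (Fin.castLEEmb hℓ.le)
  have hdet := (hMk.submatrix (Fin.castLEEmb hℓ.le)).isUnit_det_basisMatrix
    (Finset.univ.filter (fun j => Fin.castLEEmb hℓ.le j ∈ B))
  have key := Matrix.inv_mulVec_apply_of_submatrix _ (Fin.castLEEmb hℓ.le)
    (hMk.isUnit_det_basisMatrix B) (hsub ▸ hdet)
    (fun i j hj => hzero _ j i.2 (not_lt.mp fun hlt => hj ⟨⟨j, hlt⟩, rfl⟩))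
    (fun j => q (Fin.castLE hkn j)) i
  exact key.trans (congrArg (fun A => (A⁻¹ *ᵥ _) i) hsub.symm)
end

section
/- Let M ∈ ℝ^{n×n} be a P-matrix and q ∈ ℝⁿ such that LCP(M,q) is nondegenerate. Then the digraph O(M,q) has a unique sink (a vertex with no outgoing arcs), and this sink equals the unique optimal basis of LCP(M,q). -/
open Matrix

/-- `B` is a sink of the digraph `O(M,q)`: it has no outgoing arc,
i.e. there is no `i` with `(M̄_B⁻¹ q)_i < 0`. -/
def IsSink {ι : Type*} [Fintype ι] [DecidableEq ι]
    (M : Matrix ι ι ℝ) (q : ι → ℝ) (B : Finset ι) : Prop :=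
  ∀ i, ¬ ((basisMatrix M B)⁻¹ *ᵥ q) i < 0

section PMatrix

variable {ι : Type*} [Fintype ι] [DecidableEq ι]

/-- The matrix with the rows of `M` indexed by `K` and the rows of the identity elsewhere. -/
def rowPiece (K : Finset ι) (M : Matrix ι ι ℝ) : Matrix ι ι ℝ :=
  fun i => if i ∈ K then M i else Pi.single i 1

theorem det_rowPiece (K : Finset ι) (M : Matrix ι ι ℝ) :
    (rowPiece K M).det = (M.submatrix (fun i : K => i.1) (fun j : K => j.1)).det := by
  rw [twoBlockTriangular_det (rowPiece K M) (· ∈ K) fun i hi j hj => by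
    simp [rowPiece, hi, show j ≠ i from fun h => hi (h ▸ hj)]]
  have h₁ : (rowPiece K M).toSquareBlockProp (· ∈ K) =
      M.submatrix (fun i : K => i.1) (fun j : K => j.1) := by
    ext i j
    simp [rowPiece, toSquareBlockProp_def]
  have h₂ : (rowPiece K M).toSquareBlockProp (fun i => ¬ i ∈ K) = 1 := by
    ext i j
    simp [rowPiece, toSquareBlockProp_def, i.2, one_apply, Pi.single_apply, Subtype.ext_iff,
      eq_comm]
  rw [h₁, h₂, det_one, mul_one]
  convert rfl

theorem isPMatrix_iff_det_rowPiece_pos {M : Matrix ι ι ℝ} :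
    IsPMatrix M ↔ ∀ K, 0 < (rowPiece K M).det :=
  forall_congr' fun K => by rw [det_rowPiece]

theorem IsPMatrix.add_single {M : Matrix ι ι ℝ} (hM : IsPMatrix M) (i : ι) {t : ℝ}
    (ht : 0 ≤ t) : IsPMatrix (M + diagonal (Pi.single i t)) := by
  rw [isPMatrix_iff_det_rowPiece_pos] at hM ⊢
  intro K
  by_cases hi : i ∈ K
  · have h : rowPiece K (M + diagonal (Pi.single i t)) =
        (rowPiece K M).updateRow i (M i + t • Pi.single i 1) := by
      ext a b
      by_cases ha : a = i
      · subst ha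
        by_cases hb : b = a
        · subst hb; simp [rowPiece, hi]
        · simp [rowPiece, hi, hb, diagonal_apply_ne' _ hb]
      · by_cases haK : a ∈ K <;> by_cases hb : a = b <;>
          simp_all [rowPiece, updateRow_apply]
    have h₁ : (rowPiece K M).updateRow i (M i) = rowPiece K M := by
      ext a b
      by_cases ha : a = i <;> simp_all [rowPiece, updateRow_apply]
    have h₂ : (rowPiece K M).updateRow i (Pi.single i 1) = rowPiece (K.erase i) M := by
      ext a b
      by_cases ha : a = i <;> simp_all [rowPiece, updateRow_apply]
    rw [h, det_updateRow_add, det_updateRow_smul, h₁, h₂]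
    exact add_pos_of_pos_of_nonneg (hM K) (mul_nonneg ht (hM _).le)
  · convert hM K using 2
    ext a b
    by_cases ha : a ∈ K
    · have hai : a ≠ i := fun h => hi (h ▸ ha)
      by_cases hb : a = b <;> simp_all [rowPiece]
    · simp [rowPiece, ha]

theorem IsPMatrix.add_diagonal {M : Matrix ι ι ℝ} (hM : IsPMatrix M) {d : ι → ℝ}
    (hd : ∀ i, 0 ≤ d i) : IsPMatrix (M + diagonal d) := by
  have key : ∀ s : Finset ι, IsPMatrix (M + diagonal (∑ i ∈ s, Pi.single i (d i))) := by
    intro s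
    induction s using Finset.induction_on with
    | empty => simpa using hM
    | insert i s hi ih =>
      have h := ih.add_single i (hd i)
      rw [add_assoc, diagonal_add] at h
      rwa [Finset.sum_insert hi, add_comm (Pi.single i _)]
  simpa only [Finset.univ_sum_single] using key Finset.univ

/-- A P-matrix does not reverse the sign of any nonzero vector. -/
theorem IsPMatrix.eq_zero_of_mul_mulVec_nonpos {M : Matrix ι ι ℝ} (hM : IsPMatrix M)
    {u : ι → ℝ} (hu : ∀ i, u i * (M *ᵥ u) i ≤ 0) : u = 0 := by
  set d : ι → ℝ := fun i => -((M *ᵥ u) i / u i) with hd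
  have hd0 : ∀ i, 0 ≤ d i := fun i => by
    have h : d i = -(u i * (M *ᵥ u) i) / (u i * u i) := by
      by_cases h : u i = 0
      · simp [hd, h]
      · simp only [hd]; field_simp
    rw [h]
    exact div_nonneg (neg_nonneg.2 (hu i)) (mul_self_nonneg _)
  refine eq_zero_of_mulVec_eq_zero (isPMatrix_iff_det_rowPiece_pos.1 (hM.add_diagonal hd0)
    (Finset.univ.filter (u · ≠ 0))).ne' (funext fun i => ?_)
  by_cases hi : u i = 0
  · simp [mulVec, rowPiece, hi]
  · have h : (rowPiece (Finset.univ.filter (u · ≠ 0)) (M + diagonal d) *ᵥ u) i =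
        ((M + diagonal d) *ᵥ u) i := by
      simp [mulVec, rowPiece, hi]
    rw [h, add_mulVec, Pi.add_apply, mulVec_diagonal]
    simp [hd, hi]

theorem basisMatrix_mulVec (M : Matrix ι ι ℝ) (B : Finset ι) (x : ι → ℝ) :
    basisMatrix M B *ᵥ x =
      (fun i => if i ∈ B then 0 else x i) - M *ᵥ (fun i => if i ∈ B then x i else 0) := by
  ext i
  have h : (if i ∈ B then 0 else x i) = ∑ j, if i = j then (if j ∈ B then 0 else x j) else 0 := by
    simp
  simp only [mulVec, dotProduct, Pi.sub_apply, h, ← Finset.sum_sub_distrib]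
  refine Finset.sum_congr rfl fun j _ => ?_
  by_cases hj : j ∈ B <;> by_cases hij : i = j <;> simp [basisMatrix, hj, hij]

theorem IsPMatrix.det_basisMatrix_ne_zero {M : Matrix ι ι ℝ} (hM : IsPMatrix M)
    (B : Finset ι) : (basisMatrix M B).det ≠ 0 := by
  intro h
  obtain ⟨v, hv0, hv⟩ := exists_mulVec_eq_zero_iff.2 h
  rw [basisMatrix_mulVec, sub_eq_zero] at hv
  have hz := hM.eq_zero_of_mul_mulVec_nonpos (u := fun i => if i ∈ B then v i else 0) fun i => by
    rw [← hv]
    by_cases hi : i ∈ B <;> simp [hi]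
  rw [hz, mulVec_zero] at hv
  refine hv0 (funext fun i => ?_)
  by_cases hi : i ∈ B
  · simpa [hi] using congrFun hz i
  · simpa [hi] using congrFun hv i

theorem IsPMatrix.wvec_sub_mulVec_zvec {M : Matrix ι ι ℝ} (hM : IsPMatrix M)
    (q : ι → ℝ) (B : Finset ι) : wvec M q B - M *ᵥ zvec M q B = q := by
  have h := basisMatrix_mulVec M B ((basisMatrix M B)⁻¹ *ᵥ q)
  rw [mulVec_mulVec, mul_nonsing_inv _ (hM.det_basisMatrix_ne_zero B).isUnit, one_mulVec] at h
  exact h.symm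

theorem IsPMatrix.isSink_iff_optimalBasis {M : Matrix ι ι ℝ} (hM : IsPMatrix M)
    (q : ι → ℝ) (B : Finset ι) : IsSink M q B ↔ OptimalBasis M q B := by
  constructor
  · intro h
    refine ⟨hM.wvec_sub_mulVec_zvec q B, fun i => ?_, fun i => ?_,
      Finset.sum_eq_zero fun i _ => ?_⟩
    · unfold wvec
      split_ifs
      exacts [le_rfl, not_lt.1 (h i)]
    · unfold zvec
      split_ifs
      exacts [not_lt.1 (h i), le_rfl]
    · by_cases hi : i ∈ B <;> simp [wvec, zvec, hi]
  · rintro ⟨-, hw, hz, -⟩ i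
    by_cases hi : i ∈ B
    · simpa [zvec, hi] using hz i
    · simpa [wvec, hi] using hw i

/-- The set of directions of the arcs of `O(M,q)` leaving `B`. -/
noncomputable def outmap (M : Matrix ι ι ℝ) (q : ι → ℝ) (B : Finset ι) : Finset ι :=
  Finset.univ.filter fun i => ((basisMatrix M B)⁻¹ *ᵥ q) i < 0

theorem isSink_iff_outmap_eq_empty {M : Matrix ι ι ℝ} {q : ι → ℝ} {B : Finset ι} :
    IsSink M q B ↔ outmap M q B = ∅ := by
  simp [IsSink, outmap, Finset.filter_eq_empty_iff]

theorem IsPMatrix.outmap_injective {M : Matrix ι ι ℝ} (hM : IsPMatrix M) {q : ι → ℝ}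
    (hnd : Nondeg M q) : Function.Injective (outmap M q) := by
  intro B C h
  have hpos : ∀ i, 0 ≤ ((basisMatrix M B)⁻¹ *ᵥ q) i * ((basisMatrix M C)⁻¹ *ᵥ q) i := fun i => by
    have hi := Finset.ext_iff.1 h i
    simp only [outmap, Finset.mem_filter, Finset.mem_univ, true_and] at hi
    rcases lt_or_ge (((basisMatrix M B)⁻¹ *ᵥ q) i) 0 with hB | hB
    · exact mul_nonneg_of_nonpos_of_nonpos hB.le (hi.1 hB).le
    · exact mul_nonneg hB (not_lt.1 fun hC => hB.not_gt (hi.2 hC))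
  have hw : M *ᵥ (zvec M q B - zvec M q C) = wvec M q B - wvec M q C := by
    rw [mulVec_sub]
    linear_combination hM.wvec_sub_mulVec_zvec q C - hM.wvec_sub_mulVec_zvec q B
  have hz := hM.eq_zero_of_mul_mulVec_nonpos (u := zvec M q B - zvec M q C) fun i => by
    rw [hw]
    have := hpos i
    by_cases hB : i ∈ B <;> by_cases hC : i ∈ C <;> simp [wvec, zvec, hB, hC] <;> linarith
  ext i
  have hi := congrFun hz i
  by_cases hB : i ∈ B <;> by_cases hC : i ∈ C <;> simp [zvec, hB, hC] at hi ⊢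
  exacts [hnd B i hi, hnd C i hi]

end PMatrix

/-- under nondegeneracy, the digraph `O(M,q)` of a P-matrix has a
unique sink, and the sinks are exactly the optimal bases of LCP(M,q). -/
theorem stmt_12 (n : ℕ) (M : Matrix (Fin n) (Fin n) ℝ) (hM : IsPMatrix M)
    (q : Fin n → ℝ) (hnd : Nondeg M q) :
    (∃! B : Finset (Fin n), IsSink M q B) ∧
      ∀ B : Finset (Fin n), IsSink M q B ↔ OptimalBasis M q B := by
  obtain ⟨B, hB⟩ := (Finite.surjective_of_injective (hM.outmap_injective hnd)) ∅
  refine ⟨⟨B, isSink_iff_outmap_eq_empty.2 hB, fun C hC => hM.outmap_injective hnd ?_⟩,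
    hM.isSink_iff_optimalBasis q⟩
  rw [hB, isSink_iff_outmap_eq_empty.1 hC]
end
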